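/- arXiv:1511.03860 — 7 statements merged into one kernel-verified Lean document; each statement's English description precedes it below -/
import Mathlib

section
/- For every set S of positive integers with 1 ∈ S, the set E(S) of exponentially S-numbers has a natural density: the quotient #{n ≤ x : n ∈ E(S)}/x tends, as x → ∞, to the value ∏_p (1 + Σ_{i≥2} (u(i) − u(i−1))/p^i), where the product runs over all primes p and u is the characteristic function of S. -/
open scoped Classical

/-- `charFn S` is the characteristic function `u` of a set `S` of positive integers. -/
noncomputable def charFn (S : Set ℕ) (n : ℕ) : ℝ := if n ∈ S then 1 else 0

/-- `H S = ∏_p (1 + Σ_{i ≥ 2} (u(i) - u(i-1)) / p^i)`, the product over all primes. -/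
noncomputable def H (S : Set ℕ) : ℝ :=
  ∏' p : Nat.Primes,
    (1 + ∑' i : ℕ, (charFn S (i + 2) - charFn S (i + 1)) / ((p : ℕ) : ℝ) ^ (i + 2))

/-- The exponentially `S`-numbers: positive integers all of whose prime-factorization
exponents lie in `S`. -/
def ExpS (S : Set ℕ) : Set ℕ :=
  {N | 0 < N ∧ ∀ p : ℕ, p.Prime → p ∣ N → N.factorization p ∈ S}

/-- The set `D` of all densities `H S` as `S` ranges over sets of positive integers
containing `1`. -/
noncomputable def densitySet : Set ℝ :=
  {x | ∃ S : Set ℕ, 1 ∈ S ∧ (∀ n ∈ S, 0 < n) ∧ H S = x}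

open ArithmeticFunction ArithmeticFunction.zeta

/-- **Wintner's mean value theorem**: if `∑ |g n| / n` converges, then the mean value of `g * ζ`
is `∑ g n / n`. -/
theorem tendsto_sum_mul_zeta_div (g : ArithmeticFunction ℝ)
    (hg : Summable fun n : ℕ => ‖g n / (n : ℝ)‖) :
    Filter.Tendsto
      (fun x : ℕ => (∑ n ∈ Finset.Ioc 0 x, (g * (ζ : ArithmeticFunction ℝ)) n) / (x : ℝ))
      Filter.atTop (nhds (∑' n : ℕ, g n / (n : ℝ))) := by
  have key : ∀ x : ℕ, (∑ n ∈ Finset.Ioc 0 x, (g * (ζ : ArithmeticFunction ℝ)) n) / (x : ℝ)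
      = ∑' n : ℕ, g n * (((x / n : ℕ) : ℝ) / (x : ℝ)) := by
    intro x
    rw [sum_Ioc_mul_zeta_eq_sum, Finset.sum_div, tsum_eq_sum (s := Finset.Ioc 0 x)]
    · exact Finset.sum_congr rfl fun n _ => mul_div_assoc _ _ _
    · intro n hn
      rcases Nat.eq_zero_or_pos n with rfl | hn0
      · simp
      · have : x < n := by
          by_contra! h
          exact hn (Finset.mem_Ioc.2 ⟨hn0, h⟩)
        simp [Nat.div_eq_of_lt this]
  simp_rw [key]
  refine tendsto_tsum_of_dominated_convergence hg (fun n => ?_) (Filter.Eventually.of_forall ?_)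
  · rcases Nat.eq_zero_or_pos n with rfl | hn0
    · simp
    · have h := (tendsto_nat_floor_mul_div_atTop (R := ℝ) (a := (n : ℝ)⁻¹) (by positivity)).comp
        tendsto_natCast_atTop_atTop
      rw [div_eq_mul_inv]
      refine (h.congr fun x => ?_).const_mul _
      simp only [Function.comp_apply]
      rw [inv_mul_eq_div, Nat.floor_div_eq_div]
  · intro x n
    rw [div_eq_mul_inv (g n), norm_mul, norm_mul]
    refine mul_le_mul_of_nonneg_left ?_ (norm_nonneg (g n))
    rw [Real.norm_of_nonneg (by positivity), Real.norm_of_nonneg (by positivity)]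
    rcases Nat.eq_zero_or_pos x with rfl | hx
    · simp
    · rw [div_le_iff₀ (by positivity), inv_mul_eq_div]
      exact Nat.cast_div_le

/-- A function multiplicative on coprime arguments whose local factors satisfy
`∑ₑ ‖f (p ^ e)‖ ≤ 1 + b p` with `∑ b p` convergent is absolutely summable. -/
theorem summable_norm_of_tsum_prime_pow_le {f : ℕ → ℝ} (h1 : f 1 = 1)
    (hmul : ∀ {m n : ℕ}, m.Coprime n → f (m * n) = f m * f n) {b : ℕ → ℝ} (hb0 : ∀ n, 0 ≤ b n)
    (hb : Summable b) (hs : ∀ {p : ℕ}, p.Prime → Summable fun e : ℕ => ‖f (p ^ e)‖)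
    (hle : ∀ p : ℕ, p.Prime → ∑' e : ℕ, ‖f (p ^ e)‖ ≤ 1 + b p) (h0 : f 0 = 0) :
    Summable fun n : ℕ => ‖f n‖ := by
  refine summable_of_sum_range_le (c := Real.exp (∑' n, b n)) (fun n => norm_nonneg (f n)) fun N => ?_
  obtain ⟨hsum, hhas⟩ := EulerProduct.summable_and_hasSum_smoothNumbers_prod_primesBelow_tsum
    (f := fun n => ‖f n‖) (by simp [h1]) (fun h => by simp [hmul h]) (fun hp => by simpa using hs hp) N
  calc ∑ n ∈ Finset.range N, ‖f n‖
      ≤ ∑' m : N.smoothNumbers, ‖f m‖ := by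
        rw [tsum_subtype N.smoothNumbers fun n => ‖f n‖]
        have hind : Summable (N.smoothNumbers.indicator fun n => ‖f n‖) :=
          summable_subtype_iff_indicator.1 hhas.summable
        refine le_trans (Finset.sum_le_sum fun n hn => ?_)
          (hind.sum_le_tsum (Finset.range N)
            fun n _ => Set.indicator_nonneg (fun m _ => norm_nonneg (f m)) n)
        rcases Nat.eq_zero_or_pos n with rfl | hn0
        · simp [h0, Set.indicator_nonneg]
        · rw [Set.indicator_of_mem (Nat.mem_smoothNumbers_of_lt hn0 (Finset.mem_range.1 hn))]
    _ = ∏ p ∈ N.primesBelow, ∑' e : ℕ, ‖f (p ^ e)‖ := hhas.tsum_eq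
    _ ≤ ∏ p ∈ N.primesBelow, Real.exp (b p) := by
        refine Finset.prod_le_prod (fun p _ => tsum_nonneg fun _ => norm_nonneg _) fun p hp => ?_
        have := hle p (Nat.prime_of_mem_primesBelow hp)
        linarith [Real.add_one_le_exp (b p)]
    _ = Real.exp (∑ p ∈ N.primesBelow, b p) := (Real.exp_sum _ _).symm
    _ ≤ Real.exp (∑' n, b n) := Real.exp_le_exp.2 (hb.sum_le_tsum _ fun n _ => hb0 n)

/-- The indicator of the exponentially `S`-numbers, as an arithmetic function. -/
noncomputable def expSIndicator (S : Set ℕ) : ArithmeticFunction ℝ :=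
  ⟨fun n => if n ∈ ExpS S then 1 else 0, by simp [ExpS]⟩

theorem expSIndicator_apply (S : Set ℕ) (n : ℕ) :
    expSIndicator S n = if n ∈ ExpS S then 1 else 0 := rfl

theorem mul_mem_expS_iff {S : Set ℕ} {m n : ℕ} (hmn : m.Coprime n) :
    m * n ∈ ExpS S ↔ m ∈ ExpS S ∧ n ∈ ExpS S := by
  simp only [ExpS, Set.mem_ofPred_eq, CanonicallyOrderedAdd.mul_pos]
  constructor
  · rintro ⟨⟨hm, hn⟩, h⟩
    refine ⟨⟨hm, fun p hp hpm => ?_⟩, hn, fun p hp hpn => ?_⟩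
    · rw [← Nat.factorization_eq_of_coprime_left hmn
        (Nat.mem_primeFactorsList hm.ne' |>.2 ⟨hp, hpm⟩)]
      exact h p hp (hpm.mul_right n)
    · rw [← Nat.factorization_eq_of_coprime_right hmn
        (Nat.mem_primeFactorsList hn.ne' |>.2 ⟨hp, hpn⟩)]
      exact h p hp (hpn.mul_left m)
  · rintro ⟨⟨hm, hm'⟩, hn, hn'⟩
    refine ⟨⟨hm, hn⟩, fun p hp hpmn => ?_⟩
    rcases hp.dvd_mul.1 hpmn with hpm | hpn
    · rw [Nat.factorization_eq_of_coprime_left hmn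
        (Nat.mem_primeFactorsList hm.ne' |>.2 ⟨hp, hpm⟩)]
      exact hm' p hp hpm
    · rw [Nat.factorization_eq_of_coprime_right hmn
        (Nat.mem_primeFactorsList hn.ne' |>.2 ⟨hp, hpn⟩)]
      exact hn' p hp hpn

theorem isMultiplicative_expSIndicator (S : Set ℕ) : (expSIndicator S).IsMultiplicative := by
  refine ⟨by simp [expSIndicator_apply, ExpS, Nat.dvd_one, Nat.not_prime_one], fun {m n} h => ?_⟩
  simp only [expSIndicator_apply, mul_mem_expS_iff h, ite_and]
  split_ifs <;> simp

theorem expSIndicator_prime_pow (S : Set ℕ) {p : ℕ} (hp : p.Prime) (k : ℕ) :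
    expSIndicator S (p ^ (k + 1)) = charFn S (k + 1) := by
  have : p ^ (k + 1) ∈ ExpS S ↔ k + 1 ∈ S := by
    simp only [ExpS, Set.mem_ofPred_eq, hp.pos, pow_pos, true_and]
    constructor
    · intro h
      simpa [hp.factorization_self] using h p hp (dvd_pow_self p k.succ_ne_zero)
    · intro h q hq hqp
      obtain rfl := (Nat.prime_dvd_prime_iff_eq hq hp).1 (hq.dvd_of_dvd_pow hqp)
      simpa [hp.factorization_self] using h
  simp [expSIndicator_apply, charFn, this]

/-- The Möbius transform of the indicator of the exponentially `S`-numbers. -/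
noncomputable def expSMoebius (S : Set ℕ) : ArithmeticFunction ℝ :=
  expSIndicator S * ((moebius : ArithmeticFunction ℤ) : ArithmeticFunction ℝ)

theorem expSMoebius_mul_zeta (S : Set ℕ) :
    expSMoebius S * (ζ : ArithmeticFunction ℝ) = expSIndicator S := by
  rw [expSMoebius, mul_assoc, coe_moebius_mul_coe_zeta, mul_one]

theorem isMultiplicative_expSMoebius (S : Set ℕ) : (expSMoebius S).IsMultiplicative :=
  (isMultiplicative_expSIndicator S).mul isMultiplicative_moebius.intCast

theorem expSMoebius_prime_pow_succ (S : Set ℕ) {p : ℕ} (hp : p.Prime) (k : ℕ) :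
    expSMoebius S (p ^ (k + 1)) = expSIndicator S (p ^ (k + 1)) - expSIndicator S (p ^ k) := by
  have h (j : ℕ) : expSIndicator S (p ^ j) = ∑ i ∈ Finset.range (j + 1), expSMoebius S (p ^ i) := by
    rw [← expSMoebius_mul_zeta, coe_mul_zeta_apply, Nat.sum_divisors_prime_pow hp]
  rw [h, h, Finset.sum_range_succ _ (k + 1), add_sub_cancel_left]

theorem expSMoebius_prime {S : Set ℕ} (h1 : 1 ∈ S) {p : ℕ} (hp : p.Prime) :
    expSMoebius S p = 0 := by
  have h := expSMoebius_prime_pow_succ S hp 0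
  rw [expSIndicator_prime_pow S hp, pow_zero, (isMultiplicative_expSIndicator S).map_one] at h
  simpa [charFn, h1] using h

theorem expSMoebius_prime_pow_add_two (S : Set ℕ) {p : ℕ} (hp : p.Prime) (k : ℕ) :
    expSMoebius S (p ^ (k + 2)) = charFn S (k + 2) - charFn S (k + 1) := by
  rw [expSMoebius_prime_pow_succ S hp (k + 1), expSIndicator_prime_pow S hp,
    expSIndicator_prime_pow S hp]

theorem norm_expSMoebius_div_prime_pow_le (S : Set ℕ) {p : ℕ} (hp : p.Prime) (k : ℕ) :
    ‖expSMoebius S (p ^ (k + 2)) / ((p ^ (k + 2) : ℕ) : ℝ)‖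
      ≤ ((p : ℝ) ^ 2)⁻¹ * (1 / 2) ^ k := by
  have hp0 : (0 : ℝ) < p := by exact_mod_cast hp.pos
  have hnum : ‖expSMoebius S (p ^ (k + 2))‖ ≤ 1 := by
    rw [expSMoebius_prime_pow_add_two S hp]
    simp only [charFn]
    split_ifs <;> simp
  rw [norm_div, Nat.cast_pow, Real.norm_of_nonneg (pow_nonneg hp0.le _), div_eq_mul_inv]
  calc _ ≤ 1 * ((p : ℝ) ^ (k + 2))⁻¹ := by gcongr
    _ = ((p : ℝ) ^ 2)⁻¹ * (1 / (p : ℝ)) ^ k := by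
        rw [one_mul, pow_add, mul_inv, mul_comm, one_div, inv_pow]
    _ ≤ _ := by
        gcongr
        exact_mod_cast hp.two_le

theorem summable_expSMoebius_prime_pow (S : Set ℕ) {p : ℕ} (hp : p.Prime) :
    Summable fun e : ℕ => ‖expSMoebius S (p ^ e) / ((p ^ e : ℕ) : ℝ)‖ := by
  rw [← summable_nat_add_iff 2]
  exact Summable.of_nonneg_of_le (fun _ => norm_nonneg _)
    (norm_expSMoebius_div_prime_pow_le S hp) (summable_geometric_two.mul_left _)

theorem summable_norm_expSMoebius_div {S : Set ℕ} (h1 : 1 ∈ S) :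
    Summable fun n : ℕ => ‖expSMoebius S n / (n : ℝ)‖ := by
  have hg := isMultiplicative_expSMoebius S
  refine summable_norm_of_tsum_prime_pow_le (f := fun n : ℕ => expSMoebius S n / (n : ℝ))
    (b := fun n : ℕ => ((n : ℝ) ^ 2)⁻¹ * 2) (by simp [hg.map_one])
    (fun h => by rw [hg.map_mul_of_coprime h, Nat.cast_mul, mul_div_mul_comm])
    (fun n => by positivity) ((Real.summable_nat_pow_inv.2 one_lt_two).mul_right 2)
    (summable_expSMoebius_prime_pow S) (fun p hp => ?_) (by simp)
  have hs := summable_expSMoebius_prime_pow S hp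
  rw [← hs.sum_add_tsum_nat_add 2, Finset.sum_range_succ, Finset.sum_range_one]
  simp only [pow_zero, pow_one, hg.map_one, expSMoebius_prime h1 hp]
  have := ((summable_nat_add_iff 2).2 hs).tsum_le_tsum (norm_expSMoebius_div_prime_pow_le S hp)
    (summable_geometric_two.mul_left _)
  rw [tsum_mul_left, tsum_geometric_two] at this
  simpa using this

theorem tsum_expSMoebius_div {S : Set ℕ} (h1 : 1 ∈ S) :
    ∑' n : ℕ, expSMoebius S n / (n : ℝ) = H S := by
  have hg := isMultiplicative_expSMoebius S
  have h := EulerProduct.eulerProduct_hasProd (f := fun n : ℕ => expSMoebius S n / (n : ℝ))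
    (by simp [hg.map_one])
    (fun h => by rw [hg.map_mul_of_coprime h, Nat.cast_mul, mul_div_mul_comm])
    (summable_norm_expSMoebius_div h1) (by simp)
  rw [← h.tprod_eq, H]
  refine tprod_congr fun p => ?_
  rw [← (summable_expSMoebius_prime_pow S p.2).of_norm.sum_add_tsum_nat_add 2,
    Finset.sum_range_succ, Finset.sum_range_one]
  simp [hg.map_one, expSMoebius_prime h1 p.2, expSMoebius_prime_pow_add_two S p.2]

theorem density_of_expS (S : Set ℕ) (h1 : 1 ∈ S) (hpos : ∀ n ∈ S, 0 < n) :
    Filter.Tendsto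
      (fun x : ℕ => (((Finset.Icc 1 x).filter (fun n => n ∈ ExpS S)).card : ℝ) / (x : ℝ))
      Filter.atTop (nhds (H S)) := by
  rw [← tsum_expSMoebius_div h1]
  refine (tendsto_sum_mul_zeta_div _ (summable_norm_expSMoebius_div h1)).congr fun x => ?_
  rw [expSMoebius_mul_zeta, ← Finset.Icc_add_one_left_eq_Ioc, zero_add]
  simp [expSIndicator_apply]
end

section
/- For every set S of positive integers with 1 ∈ S, the value H(S) = ∏_p (1 + Σ_{i≥2} (u(i) − u(i−1))/p^i) satisfies 6/π² ≤ H(S) ≤ 1. -/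
open scoped Classical

theorem tsum_sub_shift_eq (u : ℕ → ℝ) (hu : ∀ n, 0 ≤ u n ∧ u n ≤ 1) {x : ℝ}
    (h0 : 0 ≤ x) (h1 : x < 1) :
    ∑' i : ℕ, (u (i + 1) - u i) * x ^ (i + 2) =
      (1 - x) * ∑' i : ℕ, u (i + 1) * x ^ (i + 2) - u 0 * x ^ 2 := by
  have hs : Summable fun i : ℕ => u i * x ^ (i + 2) :=
    Summable.of_nonneg_of_le (fun i => mul_nonneg (hu i).1 (by positivity))
      (fun i => mul_le_of_le_one_left (by positivity) (hu i).2)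
      ((summable_nat_add_iff 2).2 (summable_geometric_of_lt_one h0 h1))
  have hs' : Summable fun i : ℕ => u (i + 1) * x ^ (i + 2) :=
    Summable.of_nonneg_of_le (fun i => mul_nonneg (hu _).1 (by positivity))
      (fun i => mul_le_of_le_one_left (by positivity) (hu _).2)
      ((summable_nat_add_iff 2).2 (summable_geometric_of_lt_one h0 h1))
  have hshift : ∑' i : ℕ, u i * x ^ (i + 2) =
      u 0 * x ^ 2 + x * ∑' i : ℕ, u (i + 1) * x ^ (i + 2) := by
    rw [hs.tsum_eq_zero_add, ← tsum_mul_left]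
    congr 1
    exact tsum_congr fun i => by ring
  simp_rw [sub_mul]
  rw [hs'.tsum_sub hs, hshift]
  ring

/-- If `u` takes values in `[0, 1]` and `u 0 = 1`, the differences of `u` weighted by powers of `x`
sum to a value between `-x ^ 2` and `0`. -/
theorem tsum_sub_shift_mem_Icc (u : ℕ → ℝ) (hu : ∀ n, 0 ≤ u n ∧ u n ≤ 1) (hu0 : u 0 = 1) {x : ℝ}
    (h0 : 0 ≤ x) (h1 : x < 1) :
    ∑' i : ℕ, (u (i + 1) - u i) * x ^ (i + 2) ∈ Set.Icc (-x ^ 2) 0 := by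
  rw [tsum_sub_shift_eq u hu h0 h1, hu0]
  have hg : HasSum (fun i : ℕ => x ^ (i + 2)) (x ^ 2 * (1 - x)⁻¹) := by
    simpa [pow_add, mul_comm] using (hasSum_geometric_of_lt_one h0 h1).mul_left (x ^ 2)
  have hle : ∀ i : ℕ, u (i + 1) * x ^ (i + 2) ≤ x ^ (i + 2) := fun i =>
    mul_le_of_le_one_left (by positivity) (hu _).2
  have hnn : ∀ i : ℕ, 0 ≤ u (i + 1) * x ^ (i + 2) := fun i => mul_nonneg (hu _).1 (by positivity)
  have hT := (Summable.of_nonneg_of_le hnn hle hg.summable).tsum_le_tsum hle hg.summable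
  rw [hg.tsum_eq] at hT
  have hT0 : 0 ≤ ∑' i : ℕ, u (i + 1) * x ^ (i + 2) := tsum_nonneg hnn
  have hx : 0 < 1 - x := by linarith
  have hmul := mul_le_mul_of_nonneg_left hT hx.le
  rw [mul_left_comm, mul_inv_cancel₀ hx.ne', mul_one] at hmul
  have := mul_nonneg hx.le hT0
  constructor <;> linarith

/-- `n ↦ 1 / n ^ 2` as a completely multiplicative function. -/
noncomputable def invSqHom : ℕ →*₀ ℝ where
  toFun n := ((n : ℝ) ^ 2)⁻¹
  map_zero' := by simp
  map_one' := by simp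
  map_mul' m n := by push_cast; rw [mul_pow, mul_inv]

theorem hasProd_one_sub_inv_prime_sq :
    HasProd (fun p : Nat.Primes => 1 - (((p : ℕ) : ℝ) ^ 2)⁻¹) (6 / Real.pi ^ 2) := by
  have hz : HasSum invSqHom (Real.pi ^ 2 / 6) := by
    simpa [invSqHom] using hasSum_zeta_two
  have hs : Summable (‖invSqHom ·‖) := hz.summable.norm
  have hp := EulerProduct.eulerProduct_completely_multiplicative_hasProd hs
  rw [hz.tsum_eq] at hp
  have hi := Filter.Tendsto.inv₀ hp (by positivity)
  rw [inv_div] at hi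
  refine Filter.Tendsto.congr (fun s => ?_) hi
  rw [← Finset.prod_inv_distrib]
  exact Finset.prod_congr rfl fun p _ => inv_inv _

theorem H_mem_Icc (S : Set ℕ) (h1 : 1 ∈ S) (hpos : ∀ n ∈ S, 0 < n) :
    6 / Real.pi ^ 2 ≤ H S ∧ H S ≤ 1 := by
  set a : Nat.Primes → ℝ := fun p =>
    ∑' i : ℕ, (charFn S (i + 2) - charFn S (i + 1)) / ((p : ℕ) : ℝ) ^ (i + 2) with ha
  have hlt (p : Nat.Primes) : (((p : ℕ) : ℝ))⁻¹ < 1 :=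
    inv_lt_one_of_one_lt₀ (by exact_mod_cast p.2.one_lt)
  have hmem (p : Nat.Primes) : a p ∈ Set.Icc (-(((p : ℕ) : ℝ) ^ 2)⁻¹) 0 := by
    have h := tsum_sub_shift_mem_Icc (fun i => charFn S (i + 1))
      (fun n => by simp only [charFn]; split_ifs <;> norm_num) (by simp [charFn, h1])
      (by positivity) (hlt p)
    simpa only [ha, inv_pow, div_eq_mul_inv] using h
  have hsum : Summable fun p : Nat.Primes => ‖a p‖ := by
    refine Summable.of_nonneg_of_le (fun p => norm_nonneg _) (fun p => ?_)
      ((Real.summable_nat_pow_inv.2 one_lt_two).comp_injective Subtype.val_injective)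
    rw [Real.norm_of_nonpos (hmem p).2]
    exact neg_le.1 (hmem p).1
  have hH : HasProd (fun p => 1 + a p) (H S) := (multipliable_one_add_of_summable hsum).hasProd
  have hnn (p : Nat.Primes) : 0 ≤ 1 - (((p : ℕ) : ℝ) ^ 2)⁻¹ := by
    rw [← inv_pow, sub_nonneg]
    exact pow_le_one₀ (by positivity) (hlt p).le
  have hle (p : Nat.Primes) : 1 - (((p : ℕ) : ℝ) ^ 2)⁻¹ ≤ 1 + a p := by
    linarith [(hmem p).1]
  refine ⟨le_of_tendsto_of_tendsto' hasProd_one_sub_inv_prime_sq hH fun s =>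
    Finset.prod_le_prod (fun p _ => hnn p) fun p _ => hle p, le_of_tendsto' hH fun s =>
    Finset.prod_le_one (fun p _ => (hnn p).trans (hle p)) fun p _ => by linarith [(hmem p).2]⟩
end

section
/- If A and B are distinct sets of positive integers with 1 ∈ A and 1 ∈ B, then H(A) ≠ H(B); that is, the map S ↦ H(S) is injective on G. -/
open scoped Classical

theorem charFn_nonneg (S : Set ℕ) (n : ℕ) : 0 ≤ charFn S n := by
  unfold charFn; split_ifs <;> norm_num

theorem charFn_le_one (S : Set ℕ) (n : ℕ) : charFn S n ≤ 1 := by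
  unfold charFn; split_ifs <;> norm_num

theorem summable_charFn_mul_pow (S : Set ℕ) (a b : ℕ) {x : ℝ} (h0 : 0 ≤ x) (h1 : x < 1) :
    Summable fun i : ℕ => charFn S (i + a) * x ^ (i + b) := by
  refine Summable.of_nonneg_of_le
    (fun i => mul_nonneg (charFn_nonneg S _) (pow_nonneg h0 _))
    (fun i => mul_le_of_le_one_left (pow_nonneg h0 _) (charFn_le_one S _)) ?_
  exact (summable_nat_add_iff b).2 (summable_geometric_of_lt_one h0 h1)

theorem tsum_pow_add {x : ℝ} (h0 : 0 ≤ x) (h1 : x < 1) (b : ℕ) :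
    ∑' i : ℕ, x ^ (i + b) = x ^ b / (1 - x) := by
  simp_rw [pow_add]
  rw [tsum_mul_right, tsum_geometric_of_lt_one h0 h1, div_eq_inv_mul]

theorem tsum_charFn_mul_pow_le (S : Set ℕ) (a b : ℕ) {x : ℝ} (h0 : 0 ≤ x) (h1 : x < 1) :
    ∑' i : ℕ, charFn S (i + a) * x ^ (i + b) ≤ x ^ b / (1 - x) := by
  rw [← tsum_pow_add h0 h1]
  exact (summable_charFn_mul_pow S a b h0 h1).tsum_le_tsum
    (fun i => mul_le_of_le_one_left (pow_nonneg h0 _) (charFn_le_one S _))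
    ((summable_nat_add_iff b).2 (summable_geometric_of_lt_one h0 h1))

theorem tsum_charFn_mul_pow_nonneg (S : Set ℕ) (a b : ℕ) {x : ℝ} (h0 : 0 ≤ x) :
    0 ≤ ∑' i : ℕ, charFn S (i + a) * x ^ (i + b) :=
  tsum_nonneg fun _ => mul_nonneg (charFn_nonneg S _) (pow_nonneg h0 _)

/-- The deviation from `1` of the local factor of `H S`, as a function of `x = 1 / p`. -/
noncomputable def localTerm (S : Set ℕ) (x : ℝ) : ℝ :=
  (1 - x) * (∑' i : ℕ, charFn S (i + 2) * x ^ (i + 2)) - x ^ 2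

theorem tsum_charFn_sub_eq_localTerm {S : Set ℕ} (hS : 1 ∈ S) {x : ℝ} (h0 : 0 ≤ x) (h1 : x < 1) :
    ∑' i : ℕ, (charFn S (i + 2) - charFn S (i + 1)) * x ^ (i + 2) = localTerm S x := by
  have hu : charFn S 1 = 1 := if_pos hS
  have hshift : ∑' i : ℕ, charFn S (i + 1) * x ^ (i + 2)
      = x ^ 2 + x * ∑' i : ℕ, charFn S (i + 2) * x ^ (i + 2) := by
    rw [(summable_charFn_mul_pow S 1 2 h0 h1).tsum_eq_zero_add, ← tsum_mul_left]
    congr 1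
    · simp [hu]
    · exact tsum_congr fun i => by ring
  simp_rw [sub_mul]
  rw [(summable_charFn_mul_pow S 2 2 h0 h1).tsum_sub (summable_charFn_mul_pow S 1 2 h0 h1),
    hshift, localTerm]
  ring

theorem abs_localTerm_le (S : Set ℕ) {x : ℝ} (h0 : 0 ≤ x) (h1 : x < 1) :
    |localTerm S x| ≤ x ^ 2 := by
  have hx : 0 < 1 - x := sub_pos.2 h1
  have hle := (le_div_iff₀ hx).1 (tsum_charFn_mul_pow_le S 2 2 h0 h1)
  have hnn := mul_nonneg hx.le (tsum_charFn_mul_pow_nonneg S 2 2 h0)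
  rw [localTerm, abs_le]
  constructor <;> linarith [sq_nonneg x]

theorem one_add_localTerm_pos (S : Set ℕ) {x : ℝ} (h0 : 0 ≤ x) (h1 : x < 1) :
    0 < 1 + localTerm S x := by
  have := neg_le_of_abs_le (abs_localTerm_le S h0 h1)
  nlinarith

theorem localTerm_sub_ge {A B : Set ℕ} {m : ℕ}
    (hagree : ∀ i < m, i + 2 ∈ A ↔ i + 2 ∈ B) (hA : m + 2 ∈ A) (hB : m + 2 ∉ B)
    {x : ℝ} (h0 : 0 ≤ x) (h1 : x < 1) :
    x ^ (m + 2) * (1 - 2 * x) ≤ localTerm A x - localTerm B x := by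
  have hx : 0 < 1 - x := sub_pos.2 h1
  have split (S : Set ℕ) : ∑' i : ℕ, charFn S (i + 2) * x ^ (i + 2)
      = ∑ i ∈ Finset.range m, charFn S (i + 2) * x ^ (i + 2) + charFn S (m + 2) * x ^ (m + 2)
        + ∑' i : ℕ, charFn S (i + (m + 3)) * x ^ (i + (m + 3)) := by
    rw [← Finset.sum_range_succ,
      ← (summable_charFn_mul_pow S 2 2 h0 h1).sum_add_tsum_nat_add (m + 1)]
    rfl
  have hcommon : ∑ i ∈ Finset.range m, charFn A (i + 2) * x ^ (i + 2)
      = ∑ i ∈ Finset.range m, charFn B (i + 2) * x ^ (i + 2) :=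
    Finset.sum_congr rfl fun i hi => by simp [charFn, hagree i (Finset.mem_range.1 hi)]
  have huA : charFn A (m + 2) = 1 := if_pos hA
  have huB : charFn B (m + 2) = 0 := if_neg hB
  have hAtail := mul_nonneg hx.le (tsum_charFn_mul_pow_nonneg A (m + 3) (m + 3) h0)
  have hBtail := (le_div_iff₀ hx).1 (tsum_charFn_mul_pow_le B (m + 3) (m + 3) h0 h1)
  rw [localTerm, localTerm, split A, split B, hcommon, huA, huB]
  have hpow : x ^ (m + 3) = x ^ (m + 2) * x := pow_succ x (m + 2)
  linarith

theorem inv_prime_mem (p : Nat.Primes) : 0 < ((p : ℕ) : ℝ)⁻¹ ∧ ((p : ℕ) : ℝ)⁻¹ ≤ 2⁻¹ := by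
  have h2 : (2 : ℝ) ≤ ((p : ℕ) : ℝ) := by exact_mod_cast p.2.two_le
  exact ⟨by positivity, inv_anti₀ two_pos h2⟩

theorem H_eq_tprod_localTerm {S : Set ℕ} (hS : 1 ∈ S) :
    H S = ∏' p : Nat.Primes, (1 + localTerm S ((p : ℕ) : ℝ)⁻¹) := by
  refine tprod_congr fun p => ?_
  obtain ⟨h0, h1⟩ := inv_prime_mem p
  rw [← tsum_charFn_sub_eq_localTerm hS h0.le (by linarith)]
  simp_rw [inv_pow, div_eq_mul_inv]

theorem summable_log_one_add_localTerm (S : Set ℕ) :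
    Summable fun p : Nat.Primes => Real.log (1 + localTerm S ((p : ℕ) : ℝ)⁻¹) := by
  refine Real.summable_log_one_add_of_summable ?_
  have hsq : Summable fun p : Nat.Primes => (((p : ℕ) : ℝ)⁻¹) ^ 2 := by
    simp_rw [inv_pow]
    exact (Real.summable_nat_pow_inv.2 one_lt_two).comp_injective Nat.Primes.coe_nat_injective
  refine Summable.of_norm_bounded hsq fun p => ?_
  obtain ⟨h0, h1⟩ := inv_prime_mem p
  simpa only [Real.norm_eq_abs] using abs_localTerm_le S h0.le (by linarith)

theorem H_lt_of_first_difference {A B : Set ℕ} (h1A : 1 ∈ A) (h1B : 1 ∈ B) {m : ℕ}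
    (hagree : ∀ i < m, i + 2 ∈ A ↔ i + 2 ∈ B) (hA : m + 2 ∈ A) (hB : m + 2 ∉ B) :
    H B < H A := by
  have hpos (S : Set ℕ) (p : Nat.Primes) : 0 < 1 + localTerm S ((p : ℕ) : ℝ)⁻¹ := by
    obtain ⟨h0, h1⟩ := inv_prime_mem p
    exact one_add_localTerm_pos S h0.le (by linarith)
  have hdiff (p : Nat.Primes) := localTerm_sub_ge hagree hA hB (inv_prime_mem p).1.le
    (by linarith [(inv_prime_mem p).2] : ((p : ℕ) : ℝ)⁻¹ < 1)
  rw [H_eq_tprod_localTerm h1A, H_eq_tprod_localTerm h1B,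
    ← Real.rexp_tsum_eq_tprod (hpos A) (summable_log_one_add_localTerm A),
    ← Real.rexp_tsum_eq_tprod (hpos B) (summable_log_one_add_localTerm B), Real.exp_lt_exp]
  refine Summable.tsum_lt_tsum (i := ⟨3, Nat.prime_three⟩) (fun p => ?_) ?_
    (summable_log_one_add_localTerm B) (summable_log_one_add_localTerm A)
  · refine Real.log_le_log (hpos B p) ?_
    obtain ⟨h0, h1⟩ := inv_prime_mem p
    have : 0 ≤ (((p : ℕ) : ℝ)⁻¹) ^ (m + 2) * (1 - 2 * ((p : ℕ) : ℝ)⁻¹) :=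
      mul_nonneg (pow_nonneg h0.le _) (by linarith)
    linarith [hdiff p]
  · refine Real.log_lt_log (hpos B _) ?_
    have h := hdiff ⟨3, Nat.prime_three⟩
    have : 0 < (((3 : ℕ) : ℝ)⁻¹) ^ (m + 2) * (1 - 2 * ((3 : ℕ) : ℝ)⁻¹) :=
      mul_pos (by positivity) (by norm_num)
    linarith

theorem H_injective (A B : Set ℕ) (h1A : 1 ∈ A) (h1B : 1 ∈ B)
    (hposA : ∀ n ∈ A, 0 < n) (hposB : ∀ n ∈ B, 0 < n) (hne : A ≠ B) :
    H A ≠ H B := by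
  have hex : ∃ m, ¬(m + 2 ∈ A ↔ m + 2 ∈ B) := by
    by_contra! h
    refine hne (Set.ext fun n => ?_)
    match n with
    | 0 => exact iff_of_false (fun h => (hposA 0 h).false) fun h => (hposB 0 h).false
    | 1 => exact iff_of_true h1A h1B
    | n + 2 => exact h n
  have hagree : ∀ i < Nat.find hex, i + 2 ∈ A ↔ i + 2 ∈ B :=
    fun i hi => not_not.1 (Nat.find_min hex hi)
  have hm := Nat.find_spec hex
  by_cases hA : Nat.find hex + 2 ∈ A
  · exact (H_lt_of_first_difference h1A h1B hagree hA fun hB => hm (iff_of_true hA hB)).ne'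
  · have hB : Nat.find hex + 2 ∈ B := by_contra fun hB => hm (iff_of_false hA hB)
    exact (H_lt_of_first_difference h1B h1A (fun i hi => (hagree i hi).symm) hB hA).ne
end

section
/- The set D = {H(S) : S a set of positive integers with 1 ∈ S} of all densities of exponentially S-numbers is uncountable. -/
open scoped Classical

/-- The power series whose coefficients are the characteristic function of `A`. -/
noncomputable def indicatorSeries (A : Set ℕ) (x : ℝ) : ℝ := ∑' i, A.indicator (fun i => x ^ i) i

lemma summable_indicator_pow (A : Set ℕ) {x : ℝ} (h0 : 0 ≤ x) (h1 : x < 1) :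
    Summable (A.indicator (fun i => x ^ i)) :=
  (summable_geometric_of_lt_one h0 h1).indicator A

lemma indicatorSeries_nonneg (A : Set ℕ) {x : ℝ} (h0 : 0 ≤ x) : 0 ≤ indicatorSeries A x :=
  tsum_nonneg fun i => Set.indicator_nonneg (fun i _ => pow_nonneg h0 i) i

lemma indicatorSeries_le (A : Set ℕ) {x : ℝ} (h0 : 0 ≤ x) (h1 : x < 1) :
    indicatorSeries A x ≤ (1 - x)⁻¹ := by
  rw [← tsum_geometric_of_lt_one h0 h1]
  exact (summable_indicator_pow A h0 h1).tsum_le_tsum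
    (fun i => Set.indicator_le_self' (fun i _ => pow_nonneg h0 i) i)
    (summable_geometric_of_lt_one h0 h1)

/-- If `n` is the first place where `A` and `B` differ, and `n ∈ A`, then the series of `A`
exceeds that of `B` by at least `x ^ n` minus the geometric tail. -/
lemma indicatorSeries_add_le {A B : Set ℕ} {n : ℕ} (hlt : ∀ m < n, m ∈ A ↔ m ∈ B)
    (hA : n ∈ A) (hB : n ∉ B) {x : ℝ} (h0 : 0 ≤ x) (h1 : x < 1) :
    indicatorSeries B x + x ^ n ≤ indicatorSeries A x + x ^ (n + 1) * (1 - x)⁻¹ := by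
  have hsA := summable_indicator_pow A h0 h1
  have hsB := summable_indicator_pow B h0 h1
  unfold indicatorSeries
  rw [← hsA.sum_add_tsum_nat_add (n + 1), ← hsB.sum_add_tsum_nat_add (n + 1),
    Finset.sum_range_succ, Finset.sum_range_succ, Set.indicator_of_mem hA,
    Set.indicator_of_notMem hB]
  have hsum : ∑ i ∈ Finset.range n, A.indicator (fun i => x ^ i) i =
      ∑ i ∈ Finset.range n, B.indicator (fun i => x ^ i) i := by
    refine Finset.sum_congr rfl fun i hi => ?_
    by_cases hi' : i ∈ B
    · rw [Set.indicator_of_mem hi', Set.indicator_of_mem ((hlt i (Finset.mem_range.1 hi)).2 hi')]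
    · rw [Set.indicator_of_notMem hi',
        Set.indicator_of_notMem (mt (hlt i (Finset.mem_range.1 hi)).1 hi')]
  have htA : 0 ≤ ∑' i, A.indicator (fun i => x ^ i) (i + (n + 1)) :=
    tsum_nonneg fun i => Set.indicator_nonneg (fun i _ => pow_nonneg h0 i) _
  have htB : ∑' i, B.indicator (fun i => x ^ i) (i + (n + 1)) ≤ x ^ (n + 1) * (1 - x)⁻¹ := by
    rw [← tsum_geometric_of_lt_one h0 h1, ← tsum_mul_left]
    refine ((summable_nat_add_iff (n + 1)).2 hsB).tsum_le_tsum (fun i => ?_)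
      ((summable_geometric_of_lt_one h0 h1).mul_left _)
    rw [← pow_add, add_comm (n + 1) i]
    exact Set.indicator_le_self' (fun i _ => pow_nonneg h0 i) _
  linarith

lemma indicatorSeries_le_of_first_diff {A B : Set ℕ} {n : ℕ} (hlt : ∀ m < n, m ∈ A ↔ m ∈ B)
    (hA : n ∈ A) (hB : n ∉ B) {x : ℝ} (h0 : 0 ≤ x) (h1 : x ≤ 1 / 2) :
    indicatorSeries B x ≤ indicatorSeries A x := by
  have h := indicatorSeries_add_le hlt hA hB h0 (by linarith)
  have : x ^ (n + 1) * (1 - x)⁻¹ ≤ x ^ n := by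
    rw [← div_eq_mul_inv, div_le_iff₀ (by linarith), pow_succ]
    exact mul_le_mul_of_nonneg_left (by linarith) (pow_nonneg h0 n)
  linarith

lemma indicatorSeries_lt_of_first_diff {A B : Set ℕ} {n : ℕ} (hlt : ∀ m < n, m ∈ A ↔ m ∈ B)
    (hA : n ∈ A) (hB : n ∉ B) {x : ℝ} (h0 : 0 < x) (h1 : x < 1 / 2) :
    indicatorSeries B x < indicatorSeries A x := by
  have h := indicatorSeries_add_le hlt hA hB h0.le (by linarith)
  have : x ^ (n + 1) * (1 - x)⁻¹ < x ^ n := by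
    rw [← div_eq_mul_inv, div_lt_iff₀ (by linarith), pow_succ]
    exact mul_lt_mul_of_pos_left (by linarith) (pow_pos h0 n)
  linarith

/-- The set of positive integers consisting of `1` and the shift by `2` of `A`. -/
def oneInsertShift (A : Set ℕ) : Set ℕ := insert 1 ((· + 2) '' A)

lemma charFn_oneInsertShift_one (A : Set ℕ) : charFn (oneInsertShift A) 1 = 1 := by
  simp [charFn, oneInsertShift]

lemma charFn_oneInsertShift_add_two_mul (A : Set ℕ) (x : ℝ) (i : ℕ) :
    charFn (oneInsertShift A) (i + 2) * x ^ i = A.indicator (fun i => x ^ i) i := by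
  simp [charFn, oneInsertShift, Set.indicator_apply]

/-- The deviation from `1` of the Euler factor of `oneInsertShift A` at `x = 1 / p`. -/
noncomputable def eulerTerm (A : Set ℕ) (x : ℝ) : ℝ := -x ^ 2 + (1 - x) * x ^ 2 * indicatorSeries A x

lemma tsum_charFn_oneInsertShift (A : Set ℕ) {p : ℝ} (hp : 1 < p) :
    ∑' i : ℕ, (charFn (oneInsertShift A) (i + 2) - charFn (oneInsertShift A) (i + 1)) / p ^ (i + 2)
      = eulerTerm A p⁻¹ := by
  set x := p⁻¹ with hx
  have h0 : 0 ≤ x := by positivity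
  have h1 : x < 1 := inv_lt_one_of_one_lt₀ hp
  have hs := summable_indicator_pow A h0 h1
  have hF : HasSum (fun i => charFn (oneInsertShift A) (i + 2) * x ^ i) (indicatorSeries A x) := by
    simp only [charFn_oneInsertShift_add_two_mul]
    exact hs.hasSum
  have hG : HasSum (fun i => charFn (oneInsertShift A) (i + 1) * x ^ i)
      (1 + x * indicatorSeries A x) := by
    rw [← hasSum_nat_add_iff' 1]
    have hsum : 1 + x * indicatorSeries A x -
        ∑ i ∈ Finset.range 1, charFn (oneInsertShift A) (i + 1) * x ^ i =
          x * indicatorSeries A x := by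
      rw [Finset.sum_range_one, zero_add, charFn_oneInsertShift_one]
      ring
    rw [hsum]
    refine (hF.mul_left x).congr_fun fun i => ?_
    ring
  convert ((hF.sub hG).mul_left (x ^ 2)).tsum_eq using 1
  · congr 1
    ext i
    rw [div_eq_mul_inv, ← inv_pow, ← hx]
    ring
  · rw [eulerTerm]
    ring

lemma eulerTerm_mem_Icc (A : Set ℕ) {x : ℝ} (h0 : 0 ≤ x) (h1 : x < 1) :
    eulerTerm A x ∈ Set.Icc (-x ^ 2) 0 := by
  have hn := indicatorSeries_nonneg A h0
  have hl : (1 - x) * indicatorSeries A x ≤ 1 := by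
    rw [← le_inv_mul_iff₀ (by linarith), mul_one]
    exact indicatorSeries_le A h0 h1
  have hm : 0 ≤ (1 - x) * indicatorSeries A x := mul_nonneg (by linarith) hn
  constructor <;> unfold eulerTerm <;> nlinarith [sq_nonneg x]

lemma Nat.Primes.inv_pos (p : Nat.Primes) : 0 < ((p : ℕ) : ℝ)⁻¹ :=
  _root_.inv_pos.2 (Nat.cast_pos.2 p.2.pos)

lemma Nat.Primes.inv_le_half (p : Nat.Primes) : ((p : ℕ) : ℝ)⁻¹ ≤ 1 / 2 := by
  rw [one_div]
  exact inv_anti₀ two_pos (by exact_mod_cast p.2.two_le)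

lemma one_add_eulerTerm_pos (A : Set ℕ) (p : Nat.Primes) :
    0 < 1 + eulerTerm A ((p : ℕ) : ℝ)⁻¹ := by
  have h0 := p.inv_pos
  have h1 := p.inv_le_half
  have h := (eulerTerm_mem_Icc A h0.le (by linarith)).1
  nlinarith

lemma summable_log_one_add_eulerTerm (A : Set ℕ) :
    Summable fun p : Nat.Primes => Real.log (1 + eulerTerm A ((p : ℕ) : ℝ)⁻¹) := by
  apply Real.summable_log_one_add_of_summable
  have hs : Summable fun p : Nat.Primes => (((p : ℕ) : ℝ)⁻¹) ^ 2 := by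
    have := (Real.summable_nat_pow_inv (p := 2)).2 one_lt_two
    simp only [inv_pow]
    exact this.comp_injective Nat.Primes.coe_nat_injective
  refine Summable.of_norm_bounded hs fun p => ?_
  have h := eulerTerm_mem_Icc A p.inv_pos.le (by linarith [p.inv_le_half])
  rw [Real.norm_eq_abs, abs_of_nonpos h.2]
  linarith [h.1]

lemma H_oneInsertShift (A : Set ℕ) :
    H (oneInsertShift A) =
      Real.exp (∑' p : Nat.Primes, Real.log (1 + eulerTerm A ((p : ℕ) : ℝ)⁻¹)) := by
  rw [Real.rexp_tsum_eq_tprod (one_add_eulerTerm_pos A) (summable_log_one_add_eulerTerm A), H]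
  refine tprod_congr fun p => ?_
  rw [tsum_charFn_oneInsertShift A (by exact_mod_cast p.2.one_lt)]

/-- The density is strictly monotone for the lexicographic order. -/
lemma H_oneInsertShift_lt {A B : Set ℕ} {n : ℕ} (hlt : ∀ m < n, m ∈ A ↔ m ∈ B)
    (hA : n ∈ A) (hB : n ∉ B) : H (oneInsertShift B) < H (oneInsertShift A) := by
  rw [H_oneInsertShift, H_oneInsertShift, Real.exp_lt_exp]
  refine Summable.tsum_lt_tsum (i := (⟨3, Nat.prime_three⟩ : Nat.Primes)) (fun p => ?_) ?_
    (summable_log_one_add_eulerTerm B) (summable_log_one_add_eulerTerm A)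
  · refine Real.log_le_log (one_add_eulerTerm_pos B p) ?_
    have h0 := p.inv_pos
    have h1 := p.inv_le_half
    unfold eulerTerm
    have := mul_le_mul_of_nonneg_left (indicatorSeries_le_of_first_diff hlt hA hB h0.le h1)
      (mul_nonneg (sub_nonneg.2 (h1.trans one_half_lt_one.le)) (sq_nonneg ((p : ℕ) : ℝ)⁻¹))
    linarith
  · refine Real.log_lt_log (one_add_eulerTerm_pos B _) ?_
    have := indicatorSeries_lt_of_first_diff hlt hA hB (x := (3 : ℝ)⁻¹) (by norm_num) (by norm_num)
    simp only [eulerTerm, Nat.cast_ofNat]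
    linarith

lemma H_oneInsertShift_injective : Function.Injective fun A => H (oneInsertShift A) := by
  intro A B hAB
  by_contra hne
  have hex : ∃ n, ¬(n ∈ A ↔ n ∈ B) := by
    by_contra! h
    exact hne (Set.ext h)
  have hlt : ∀ m < Nat.find hex, m ∈ A ↔ m ∈ B := fun m hm => not_not.1 (Nat.find_min hex hm)
  have hn := Nat.find_spec hex
  by_cases hA : Nat.find hex ∈ A
  · exact (H_oneInsertShift_lt hlt hA fun hB => hn (iff_of_true hA hB)).ne' hAB
  · have hB : Nat.find hex ∈ B := by
      by_contra hB
      exact hn (iff_of_false hA hB)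
    exact (H_oneInsertShift_lt (fun m hm => (hlt m hm).symm) hB hA).ne hAB

theorem densitySet_uncountable : ¬ densitySet.Countable := by
  intro h
  have hc : (Set.univ : Set (Set ℕ)).Countable := by
    refine Set.MapsTo.countable_of_injOn (f := fun A => H (oneInsertShift A)) (fun A _ => ?_)
      H_oneInsertShift_injective.injOn h
    refine ⟨oneInsertShift A, Set.mem_insert 1 _, ?_, rfl⟩
    rintro n (rfl | ⟨m, -, rfl⟩)
    · exact one_pos
    · exact Nat.succ_pos _
  have : Countable (Set ℕ) := Set.countable_univ_iff.1 hc
  obtain ⟨f, hf⟩ := exists_injective_nat (Set ℕ)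
  exact Function.cantor_injective f hf
end

section
/- Let S be a finite set of positive integers with 1 ∈ S and largest element s(k), and for each integer n ≥ s(k) + 2 let S_n = S ∪ {n}. Then H(S_n) → H(S) as n → ∞. -/
open scoped Classical

lemma abs_charFn_sub_le (S : Set ℕ) (m n : ℕ) : |charFn S m - charFn S n| ≤ 1 := by
  unfold charFn
  split_ifs <;> norm_num

lemma norm_charFn_term_le (S : Set ℕ) (p : Nat.Primes) (i : ℕ) :
    ‖(charFn S (i + 2) - charFn S (i + 1)) / ((p : ℕ) : ℝ) ^ (i + 2)‖ ≤
      (((p : ℕ) : ℝ) ^ 2)⁻¹ * (1 / 2) ^ i := by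
  have hp : (2 : ℝ) ≤ ((p : ℕ) : ℝ) := by exact_mod_cast p.2.two_le
  have hp0 : (0 : ℝ) < ((p : ℕ) : ℝ) := by linarith
  calc _ = |charFn S (i + 2) - charFn S (i + 1)| / ((p : ℕ) : ℝ) ^ (i + 2) := by
        rw [Real.norm_eq_abs, abs_div, abs_of_pos (pow_pos hp0 _)]
    _ ≤ 1 / ((p : ℕ) : ℝ) ^ (i + 2) := by
        gcongr
        exact abs_charFn_sub_le S _ _
    _ = (((p : ℕ) : ℝ) ^ 2)⁻¹ * (1 / (p : ℕ)) ^ i := by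
        rw [pow_add, one_div_pow]
        field_simp
    _ ≤ _ := by gcongr

lemma norm_tsum_charFn_le (S : Set ℕ) (p : Nat.Primes) :
    ‖∑' i : ℕ, (charFn S (i + 2) - charFn S (i + 1)) / ((p : ℕ) : ℝ) ^ (i + 2)‖ ≤
      (((p : ℕ) : ℝ) ^ 2)⁻¹ * 2 :=
  tsum_of_norm_bounded (hasSum_geometric_two.mul_left _) (norm_charFn_term_le S p)

lemma eventually_charFn_insert (S : Set ℕ) (m : ℕ) :
    ∀ᶠ n in Filter.atTop, charFn (insert n S) m = charFn S m := by
  filter_upwards [Filter.eventually_gt_atTop m] with n hn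
  simp [charFn, hn.ne]

theorem tendsto_H_insert (S : Set ℕ) (hfin : S.Finite) (h1 : 1 ∈ S)
    (hpos : ∀ n ∈ S, 0 < n) :
    Filter.Tendsto (fun n : ℕ => H (insert n S)) Filter.atTop (nhds (H S)) := by
  unfold H
  have hsum : Summable fun p : Nat.Primes ↦ (((p : ℕ) : ℝ) ^ 2)⁻¹ * 2 :=
    ((Real.summable_nat_pow_inv.mpr one_lt_two).comp_injective
      Nat.Primes.coe_nat_injective).mul_right 2
  refine tendsto_tprod_one_add_of_dominated_convergence hsum (fun p ↦ ?_)
    (.of_forall fun n p ↦ norm_tsum_charFn_le _ p)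
  refine tendsto_tsum_of_dominated_convergence (summable_geometric_two.mul_left _) (fun i ↦ ?_)
    (.of_forall fun n i ↦ norm_charFn_term_le _ p i)
  refine tendsto_const_nhds.congr' ?_
  filter_upwards [eventually_charFn_insert S (i + 2), eventually_charFn_insert S (i + 1)]
    with n h₂ h₁
  rw [h₂, h₁]
end

section
/- Every point of the set D = {H(S) : S a set of positive integers with 1 ∈ S} is an accumulation point of D; that is, for every S ∈ G and every ε > 0 there exists S' ∈ G with S' ≠ S and 0 < |H(S') − H(S)| < ε. -/
open scoped Classical

/-- The power series `∑_{i ≥ 1} u(i) x^i` attached to a set `S`. -/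
noncomputable def expSeries (S : Set ℕ) (x : ℝ) : ℝ := ∑' i : ℕ, charFn S (i + 1) * x ^ (i + 1)

/-- The Euler factor of `H S` at the prime `p`. -/
noncomputable def eulerFactor (S : Set ℕ) (p : Nat.Primes) : ℝ :=
  1 + ∑' i : ℕ, (charFn S (i + 2) - charFn S (i + 1)) / ((p : ℕ) : ℝ) ^ (i + 2)

theorem charFn_insert {S : Set ℕ} {k : ℕ} (hk : k ∉ S) (n : ℕ) :
    charFn (insert k S) n = charFn S n + if n = k then 1 else 0 := by
  by_cases h : n = k
  · subst h; simp [charFn, hk]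
  · simp [charFn, h]

theorem hasSum_pow_succ {x : ℝ} (h0 : 0 ≤ x) (h1 : x < 1) :
    HasSum (fun i : ℕ => x ^ (i + 1)) (x / (1 - x)) := by
  simpa [pow_succ', div_eq_mul_inv] using (hasSum_geometric_of_lt_one h0 h1).mul_left x

theorem summable_expSeries (S : Set ℕ) {x : ℝ} (h0 : 0 ≤ x) (h1 : x < 1) :
    Summable fun i : ℕ => charFn S (i + 1) * x ^ (i + 1) :=
  Summable.of_nonneg_of_le (fun _ => mul_nonneg (charFn_nonneg _ _) (pow_nonneg h0 _))
    (fun _ => mul_le_of_le_one_left (pow_nonneg h0 _) (charFn_le_one _ _))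
    (hasSum_pow_succ h0 h1).summable

theorem expSeries_eq_add {S : Set ℕ} (hS : 1 ∈ S) {x : ℝ} (h0 : 0 ≤ x) (h1 : x < 1) :
    expSeries S x = x + ∑' i : ℕ, charFn S (i + 2) * x ^ (i + 2) := by
  rw [expSeries, (summable_expSeries S h0 h1).tsum_eq_zero_add]
  simp [charFn, hS]

theorem le_expSeries {S : Set ℕ} (hS : 1 ∈ S) {x : ℝ} (h0 : 0 ≤ x) (h1 : x < 1) :
    x ≤ expSeries S x := by
  rw [expSeries_eq_add hS h0 h1]
  exact le_add_of_nonneg_right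
    (tsum_nonneg fun _ => mul_nonneg (charFn_nonneg _ _) (pow_nonneg h0 _))

theorem expSeries_le (S : Set ℕ) {x : ℝ} (h0 : 0 ≤ x) (h1 : x < 1) :
    expSeries S x ≤ x / (1 - x) := by
  rw [← (hasSum_pow_succ h0 h1).tsum_eq]
  exact (summable_expSeries S h0 h1).tsum_le_tsum
    (fun _ => mul_le_of_le_one_left (pow_nonneg h0 _) (charFn_le_one _ _))
    (hasSum_pow_succ h0 h1).summable

theorem expSeries_insert {S : Set ℕ} {k : ℕ} (hk : k ∉ S) (hk0 : k ≠ 0) {x : ℝ} (h0 : 0 ≤ x)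
    (h1 : x < 1) : expSeries (insert k S) x = expSeries S x + x ^ k := by
  obtain ⟨m, rfl⟩ := Nat.exists_eq_succ_of_ne_zero hk0
  have hm : HasSum (fun i : ℕ => if i = m then x ^ (m + 1) else 0) (x ^ (m + 1)) :=
    hasSum_ite_eq m _
  refine HasSum.tsum_eq ?_
  have hS : HasSum (fun i : ℕ => charFn S (i + 1) * x ^ (i + 1)) (expSeries S x) :=
    (summable_expSeries S h0 h1).hasSum
  convert hS.add hm using 2 with i
  rw [charFn_insert hk]
  by_cases h : i = m
  · subst h; simp [add_mul]
  · simp [h]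

theorem Nat.Primes.inv_pos_and_le_half (p : Nat.Primes) :
    0 < ((p : ℕ) : ℝ)⁻¹ ∧ ((p : ℕ) : ℝ)⁻¹ ≤ 1 / 2 := by
  have h : (2 : ℝ) ≤ (p : ℕ) := by exact_mod_cast p.2.two_le
  refine ⟨by positivity, ?_⟩
  rw [one_div]
  exact inv_anti₀ two_pos h

theorem eulerFactor_eq {S : Set ℕ} (hS : 1 ∈ S) (p : Nat.Primes) :
    eulerFactor S p = (1 - ((p : ℕ) : ℝ)⁻¹) * (1 + expSeries S ((p : ℕ) : ℝ)⁻¹) := by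
  obtain ⟨h0, h2⟩ := p.inv_pos_and_le_half
  rw [eulerFactor]
  set x := ((p : ℕ) : ℝ)⁻¹ with hx
  have h1 : x < 1 := by linarith
  have hs := summable_expSeries S h0.le h1
  have hs2 : Summable fun i : ℕ => charFn S (i + 2) * x ^ (i + 2) :=
    (summable_nat_add_iff 1).2 hs
  have key : ∑' i : ℕ, (charFn S (i + 2) - charFn S (i + 1)) / ((p : ℕ) : ℝ) ^ (i + 2) =
      ∑' i : ℕ, charFn S (i + 2) * x ^ (i + 2) - x * expSeries S x := by
    rw [expSeries, ← tsum_mul_left, ← hs2.tsum_sub (hs.mul_left x)]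
    refine tsum_congr fun i => ?_
    rw [div_eq_mul_inv, ← inv_pow, ← hx]
    ring
  rw [key]
  linarith [expSeries_eq_add hS h0.le h1]

theorem one_sub_sq_le_eulerFactor {S : Set ℕ} (hS : 1 ∈ S) (p : Nat.Primes) :
    1 - ((p : ℕ) : ℝ)⁻¹ ^ 2 ≤ eulerFactor S p := by
  obtain ⟨h0, h2⟩ := p.inv_pos_and_le_half
  rw [eulerFactor_eq hS]
  nlinarith [le_expSeries hS h0.le (by linarith)]

theorem eulerFactor_pos {S : Set ℕ} (hS : 1 ∈ S) (p : Nat.Primes) : 0 < eulerFactor S p := by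
  obtain ⟨h0, h2⟩ := p.inv_pos_and_le_half
  nlinarith [one_sub_sq_le_eulerFactor hS p]

theorem eulerFactor_le_one {S : Set ℕ} (hS : 1 ∈ S) (p : Nat.Primes) : eulerFactor S p ≤ 1 := by
  obtain ⟨h0, h2⟩ := p.inv_pos_and_le_half
  have h1 : 0 < 1 - ((p : ℕ) : ℝ)⁻¹ := by linarith
  have := (le_div_iff₀ h1).1 (expSeries_le S h0.le (by linarith))
  rw [eulerFactor_eq hS]
  linarith

theorem summable_primes_inv_sq : Summable fun p : Nat.Primes => ((p : ℕ) : ℝ)⁻¹ ^ 2 := by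
  have h := (Real.summable_nat_pow_inv (p := 2)).2 one_lt_two
  simpa [inv_pow, Function.comp_def] using
    h.comp_injective (i := fun p : Nat.Primes => (p : ℕ)) Subtype.val_injective

theorem summable_log_eulerFactor {S : Set ℕ} (hS : 1 ∈ S) :
    Summable fun p => Real.log (eulerFactor S p) := by
  have h : Summable fun p => eulerFactor S p - 1 := by
    refine Summable.of_norm_bounded summable_primes_inv_sq fun p => ?_
    rw [Real.norm_eq_abs, abs_le]
    constructor
    · linarith [one_sub_sq_le_eulerFactor hS p]
    · nlinarith [eulerFactor_le_one hS p, sq_nonneg (((p : ℕ) : ℝ)⁻¹)]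
  simpa using Real.summable_log_one_add_of_summable h

theorem H_eq_exp {S : Set ℕ} (hS : 1 ∈ S) :
    H S = Real.exp (∑' p, Real.log (eulerFactor S p)) :=
  (Real.rexp_tsum_eq_tprod (eulerFactor_pos hS) (summable_log_eulerFactor hS)).symm

theorem H_pos {S : Set ℕ} (hS : 1 ∈ S) : 0 < H S := by
  rw [H_eq_exp hS]
  exact Real.exp_pos _

theorem H_le_one {S : Set ℕ} (hS : 1 ∈ S) : H S ≤ 1 := by
  rw [H_eq_exp hS, Real.exp_le_one_iff]
  exact tsum_nonpos fun p => Real.log_nonpos (eulerFactor_pos hS p).le (eulerFactor_le_one hS p)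

theorem log_eulerFactor_insert {S : Set ℕ} (hS : 1 ∈ S) {k : ℕ} (hk : k ∉ S) (hk0 : k ≠ 0)
    (p : Nat.Primes) :
    Real.log (eulerFactor S p) < Real.log (eulerFactor (insert k S) p) ∧
      Real.log (eulerFactor (insert k S) p) ≤
        Real.log (eulerFactor S p) + ((p : ℕ) : ℝ)⁻¹ ^ k := by
  obtain ⟨h0, h2⟩ := p.inv_pos_and_le_half
  have hS' : 1 ∈ insert k S := Set.mem_insert_of_mem _ hS
  have hpos := eulerFactor_pos hS p
  have ha := le_expSeries hS h0.le (by linarith)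
  have hins := expSeries_insert hk hk0 h0.le (by linarith)
  have hf := eulerFactor_eq hS p
  have hf' := eulerFactor_eq hS' p
  set x := ((p : ℕ) : ℝ)⁻¹
  have hxk : 0 < x ^ k := pow_pos h0 k
  have hx : 0 < 1 - x := by linarith
  have hlt : eulerFactor S p < eulerFactor (insert k S) p := by
    rw [hf, hf', hins]
    exact mul_lt_mul_of_pos_left (by linarith) hx
  have hle : eulerFactor (insert k S) p ≤ eulerFactor S p * (1 + x ^ k) := by
    rw [hf, hf', hins, mul_assoc]
    refine mul_le_mul_of_nonneg_left ?_ hx.le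
    nlinarith
  refine ⟨Real.log_lt_log hpos hlt, ?_⟩
  calc Real.log (eulerFactor (insert k S) p)
      ≤ Real.log (eulerFactor S p * (1 + x ^ k)) := Real.log_le_log (hpos.trans hlt) hle
    _ = Real.log (eulerFactor S p) + Real.log (1 + x ^ k) :=
        Real.log_mul hpos.ne' (by positivity)
    _ ≤ _ := by linarith [Real.log_le_sub_one_of_pos (show 0 < 1 + x ^ k by positivity)]

/-- Adding a new exponent `n + 2` to `S` strictly increases `H S`, by an amount that tends to `0`
as `n` grows, uniformly in `S`. -/
theorem H_insert_sub {S : Set ℕ} (hS : 1 ∈ S) {n : ℕ} (hn : n + 2 ∉ S) :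
    0 < H (insert (n + 2) S) - H S ∧ H (insert (n + 2) S) - H S ≤
      Real.exp ((∑' p : Nat.Primes, ((p : ℕ) : ℝ)⁻¹ ^ 2) * (1 / 2) ^ n) - 1 := by
  have hS' : 1 ∈ insert (n + 2) S := Set.mem_insert_of_mem _ hS
  have hlog := log_eulerFactor_insert hS hn (by omega)
  have hs := summable_log_eulerFactor hS
  have hs' := summable_log_eulerFactor hS'
  have hb : Summable fun p : Nat.Primes => ((p : ℕ) : ℝ)⁻¹ ^ 2 * (1 / 2) ^ n :=
    summable_primes_inv_sq.mul_right _
  have hlt : H S < H (insert (n + 2) S) := by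
    rw [H_eq_exp hS, H_eq_exp hS', Real.exp_lt_exp]
    exact hs.tsum_lt_tsum (i := ⟨2, Nat.prime_two⟩) (fun p => (hlog p).1.le) (hlog _).1 hs'
  have hle : ∑' p, Real.log (eulerFactor (insert (n + 2) S) p) ≤
      ∑' p, Real.log (eulerFactor S p) +
        (∑' p : Nat.Primes, ((p : ℕ) : ℝ)⁻¹ ^ 2) * (1 / 2) ^ n := by
    rw [← tsum_mul_right, ← hs.tsum_add hb]
    refine hs'.tsum_le_tsum (fun p => (hlog p).2.trans ?_) (hs.add hb)
    obtain ⟨h0, h2⟩ := p.inv_pos_and_le_half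
    rw [add_comm n, pow_add]
    gcongr
  have hH : H (insert (n + 2) S) ≤
      H S * Real.exp ((∑' p : Nat.Primes, ((p : ℕ) : ℝ)⁻¹ ^ 2) * (1 / 2) ^ n) := by
    rw [H_eq_exp hS, H_eq_exp hS', ← Real.exp_add]
    exact Real.exp_le_exp.2 hle
  refine ⟨sub_pos.2 hlt, ?_⟩
  have hE : 1 ≤ Real.exp ((∑' p : Nat.Primes, ((p : ℕ) : ℝ)⁻¹ ^ 2) * (1 / 2) ^ n) :=
    Real.one_le_exp (mul_nonneg (tsum_nonneg fun _ => sq_nonneg _) (by positivity))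
  nlinarith [H_le_one hS]

theorem densitySet_accumulation (S : Set ℕ) (h1 : 1 ∈ S) (hpos : ∀ n ∈ S, 0 < n) :
    ∀ ε : ℝ, 0 < ε → ∃ S' : Set ℕ, 1 ∈ S' ∧ (∀ n ∈ S', 0 < n) ∧ S' ≠ S ∧
      0 < |H S' - H S| ∧ |H S' - H S| < ε := by
  intro ε hε
  obtain ⟨n, hn⟩ : ∃ n : ℕ,
      Real.exp ((∑' p : Nat.Primes, ((p : ℕ) : ℝ)⁻¹ ^ 2) * (1 / 2) ^ n) - 1 < ε := by
    have h : Filter.Tendsto (fun n : ℕ =>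
        Real.exp ((∑' p : Nat.Primes, ((p : ℕ) : ℝ)⁻¹ ^ 2) * (1 / 2) ^ n) - 1)
        Filter.atTop (nhds 0) := by
      have h2 := (tendsto_pow_atTop_nhds_zero_of_lt_one (r := (1 / 2 : ℝ))
        (by norm_num) (by norm_num)).const_mul (∑' p : Nat.Primes, ((p : ℕ) : ℝ)⁻¹ ^ 2)
      simpa using ((Real.continuous_exp.tendsto _).comp h2).sub_const 1
    exact (h.eventually_lt_const hε).exists
  by_cases hk : n + 2 ∈ S
  · have h1' : 1 ∈ S \ {n + 2} := ⟨h1, by simp⟩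
    have hk' : n + 2 ∉ S \ {n + 2} := by simp
    have h := H_insert_sub h1' hk'
    rw [Set.insert_sdiff_singleton, Set.insert_eq_of_mem hk] at h
    refine ⟨S \ {n + 2}, h1', fun m hm => hpos m hm.1, fun he => hk' (he.ge hk), ?_⟩
    rw [abs_sub_comm, abs_of_pos h.1]
    exact ⟨h.1, h.2.trans_lt hn⟩
  · have h := H_insert_sub h1 hk
    refine ⟨insert (n + 2) S, Set.mem_insert_of_mem _ h1, ?_,
      fun he => hk (he ▸ Set.mem_insert _ _), ?_⟩
    · rintro m (rfl | hm)
      · omega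
      · exact hpos m hm
    · rw [abs_of_pos h.1]
      exact ⟨h.1, h.2.trans_lt hn⟩
end

section
/- The set D = {H(S) : S a set of positive integers with 1 ∈ S} is a perfect subset of ℝ: it is closed and has no isolated points. -/
open scoped Classical

open Filter Topology

/-- The set containing `1`, and `m + 2` exactly when `x m` is true. -/
def setOfBits (x : ℕ → Bool) : Set ℕ := {n | n = 1 ∨ ∃ m, n = m + 2 ∧ x m = true}

/-- The `p`-th factor of the product `H S`, minus one. -/
noncomputable def factorTail (S : Set ℕ) (p : ℝ) : ℝ :=
  ∑' i : ℕ, (charFn S (i + 2) - charFn S (i + 1)) / p ^ (i + 2)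

lemma charFn_setOfBits_one (x : ℕ → Bool) : charFn (setOfBits x) 1 = 1 := by
  simp [charFn, setOfBits]

lemma charFn_setOfBits_add_two (x : ℕ → Bool) (m : ℕ) :
    charFn (setOfBits x) (m + 2) = if x m = true then 1 else 0 := by
  simp [charFn, setOfBits]

lemma densitySet_eq_range : densitySet = Set.range fun x => H (setOfBits x) := by
  ext r
  constructor
  · rintro ⟨S, h_one, hpos, rfl⟩
    refine ⟨fun m => decide (m + 2 ∈ S), ?_⟩
    have : setOfBits (fun m => decide (m + 2 ∈ S)) = S := by
      ext n
      rcases n with _ | _ | n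
      · simpa [setOfBits] using fun h => (hpos 0 h).false
      · simpa [setOfBits] using h_one
      · simp [setOfBits]
    simp only [this]
  · rintro ⟨x, rfl⟩
    refine ⟨setOfBits x, Or.inl rfl, ?_, rfl⟩
    rintro n (rfl | ⟨m, rfl, -⟩) <;> omega

lemma continuous_charFn_setOfBits (n : ℕ) : Continuous fun x => charFn (setOfBits x) n := by
  rcases n with _ | _ | m
  · simpa [charFn, setOfBits] using continuous_const
  · simpa [charFn_setOfBits_one] using continuous_const
  · simp only [charFn_setOfBits_add_two]
    exact (continuous_of_discreteTopology
      (f := fun b : Bool => if b = true then (1 : ℝ) else 0)).comp (continuous_apply m)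

lemma abs_charFn_sub_div_le (S : Set ℕ) {p : ℝ} (hp : 0 < p) (i : ℕ) :
    |(charFn S (i + 2) - charFn S (i + 1)) / p ^ (i + 2)| ≤ (1 / p ^ 2) * (1 / p) ^ i := by
  have h : |charFn S (i + 2) - charFn S (i + 1)| ≤ 1 := by
    unfold charFn
    split_ifs <;> norm_num
  have hpow : 0 < p ^ (i + 2) := by positivity
  rw [abs_div, abs_of_pos hpow]
  calc _ ≤ 1 / p ^ (i + 2) := by gcongr
    _ = _ := by rw [one_div_pow]; field_simp; ring

lemma summable_geometric_bound {p : ℝ} (hp : 2 ≤ p) :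
    Summable fun i : ℕ => (1 / p ^ 2) * (1 / p) ^ i :=
  (summable_geometric_of_lt_one (by positivity)
    (by rw [div_lt_one] <;> linarith)).mul_left _

lemma summable_charFn_sub_div (S : Set ℕ) {p : ℝ} (hp : 2 ≤ p) :
    Summable fun i : ℕ => (charFn S (i + 2) - charFn S (i + 1)) / p ^ (i + 2) :=
  .of_norm_bounded (summable_geometric_bound hp)
    fun i => abs_charFn_sub_div_le S (by linarith) i

lemma abs_factorTail_le (S : Set ℕ) {p : ℝ} (hp : 2 ≤ p) :
    |factorTail S p| ≤ 2 * (1 / p ^ 2) := by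
  have hlt : 1 / p < 1 := by rw [div_lt_one] <;> linarith
  have hgeom := (hasSum_geometric_of_lt_one (r := 1 / p) (by positivity) hlt).mul_left (1 / p ^ 2)
  have h : ‖factorTail S p‖ ≤ 1 / p ^ 2 * (1 - 1 / p)⁻¹ :=
    tsum_of_norm_bounded hgeom fun i => abs_charFn_sub_div_le S (by linarith) i
  refine h.trans ?_
  rw [mul_comm]
  gcongr
  rw [inv_le_comm₀ (by linarith) (by norm_num)]
  have : 1 / p ≤ 1 / 2 := by gcongr
  linarith

lemma abs_factorTail_le_half (S : Set ℕ) {p : ℝ} (hp : 2 ≤ p) : |factorTail S p| ≤ 1 / 2 := by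
  refine (abs_factorTail_le S hp).trans ?_
  have : 1 / p ^ 2 ≤ 1 / 2 ^ 2 := by gcongr
  linarith

lemma one_add_factorTail_pos (S : Set ℕ) {p : ℝ} (hp : 2 ≤ p) : 0 < 1 + factorTail S p := by
  linarith [(abs_le.mp (abs_factorTail_le_half S hp)).1]

lemma abs_log_one_add_le {y : ℝ} (hy : |y| ≤ 1 / 2) : |Real.log (1 + y)| ≤ 2 * |y| := by
  obtain ⟨hl, hr⟩ := abs_le.mp hy
  have hpos : 0 < 1 + y := by linarith
  have h₁ := Real.log_le_sub_one_of_pos hpos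
  have h₂ := Real.one_sub_inv_le_log_of_pos hpos
  have h₃ : |1 - (1 + y)⁻¹| ≤ 2 * |y| := by
    have : 1 - (1 + y)⁻¹ = y / (1 + y) := by field_simp; ring
    rw [this, abs_div, abs_of_pos hpos, div_le_iff₀ hpos]
    nlinarith [abs_nonneg y]
  rw [abs_le]
  constructor
  · linarith [(abs_le.mp h₃).1]
  · linarith [le_abs_self y, abs_nonneg y]

lemma two_le_prime_cast (p : Nat.Primes) : (2 : ℝ) ≤ ((p : ℕ) : ℝ) := by
  exact_mod_cast p.2.two_le

lemma abs_log_factor_le (S : Set ℕ) (p : Nat.Primes) :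
    |Real.log (1 + factorTail S (p : ℕ))| ≤ 4 * (1 / ((p : ℕ) : ℝ) ^ 2) := by
  have h := abs_log_one_add_le (abs_factorTail_le_half S (two_le_prime_cast p))
  linarith [abs_factorTail_le S (two_le_prime_cast p)]

lemma summable_primes_bound : Summable fun p : Nat.Primes => 4 * (1 / ((p : ℕ) : ℝ) ^ 2) :=
  ((Real.summable_one_div_nat_pow.mpr one_lt_two).subtype _).mul_left 4

lemma summable_log_factor (S : Set ℕ) :
    Summable fun p : Nat.Primes => Real.log (1 + factorTail S (p : ℕ)) :=
  .of_norm_bounded summable_primes_bound fun p => abs_log_factor_le S p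

lemma H_eq_exp_tsum (S : Set ℕ) :
    H S = Real.exp (∑' p : Nat.Primes, Real.log (1 + factorTail S (p : ℕ))) :=
  (Real.rexp_tsum_eq_tprod (fun p => one_add_factorTail_pos S (two_le_prime_cast p))
    (summable_log_factor S)).symm

lemma continuous_factorTail {p : ℝ} (hp : 2 ≤ p) :
    Continuous fun x => factorTail (setOfBits x) p :=
  continuous_tsum
    (fun i => ((continuous_charFn_setOfBits _).sub (continuous_charFn_setOfBits _)).div_const _)
    (summable_geometric_bound hp) fun i x => abs_charFn_sub_div_le _ (by linarith) i

lemma continuous_H_setOfBits : Continuous fun x => H (setOfBits x) := by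
  simp only [H_eq_exp_tsum]
  refine Real.continuous_exp.comp (continuous_tsum (fun p => ?_) summable_primes_bound
    fun p x => abs_log_factor_le _ p)
  exact (continuous_const.add (continuous_factorTail (two_le_prime_cast p))).log
    fun x => (one_add_factorTail_pos _ (two_le_prime_cast p)).ne'

lemma charFn_setOfBits_update_ne (x : ℕ → Bool) (k : ℕ) (b : Bool) {n : ℕ} (hn : n ≠ k + 2) :
    charFn (setOfBits (Function.update x k b)) n = charFn (setOfBits x) n := by
  rcases n with _ | _ | m
  · simp [charFn, setOfBits]
  · simp [charFn_setOfBits_one]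
  · have : m ≠ k := by omega
    simp [charFn_setOfBits_add_two, this]

lemma factorTail_lt_update {x : ℕ → Bool} {k : ℕ} (hk : x k = false) {p : ℝ} (hp : 2 ≤ p) :
    factorTail (setOfBits x) p < factorTail (setOfBits (Function.update x k true)) p := by
  rw [← sub_pos]
  unfold factorTail
  rw [← (summable_charFn_sub_div _ hp).tsum_sub (summable_charFn_sub_div _ hp),
    tsum_eq_sum (s := {k, k + 1}), Finset.sum_pair (by omega)]
  · rw [charFn_setOfBits_update_ne x k true (n := k + 1) (by omega),
      charFn_setOfBits_update_ne x k true (n := k + 1 + 2) (by omega)]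
    have h₁ : charFn (setOfBits (Function.update x k true)) (k + 2) = 1 := by
      simp [charFn_setOfBits_add_two]
    have h₀ : charFn (setOfBits x) (k + 2) = 0 := by
      simp [charFn_setOfBits_add_two, hk]
    rw [show k + 1 + 1 = k + 2 by rfl, h₀, h₁]
    have hlt : 1 / p ^ (k + 1 + 2) < 1 / p ^ (k + 2) :=
      one_div_lt_one_div_of_lt (by positivity) (pow_lt_pow_right₀ (by linarith) (by omega))
    linear_combination hlt
  · intro i hi
    simp only [Finset.mem_insert, Finset.mem_singleton, not_or] at hi
    rw [charFn_setOfBits_update_ne x k true (n := i + 2) (by omega),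
      charFn_setOfBits_update_ne x k true (n := i + 1) (by omega), sub_self]

lemma H_lt_H_update {x : ℕ → Bool} {k : ℕ} (hk : x k = false) :
    H (setOfBits x) < H (setOfBits (Function.update x k true)) := by
  rw [H_eq_exp_tsum, H_eq_exp_tsum, Real.exp_lt_exp]
  have hlt (p : Nat.Primes) : Real.log (1 + factorTail (setOfBits x) (p : ℕ)) <
      Real.log (1 + factorTail (setOfBits (Function.update x k true)) (p : ℕ)) :=
    Real.log_lt_log (one_add_factorTail_pos _ (two_le_prime_cast p))
      (add_lt_add_right (factorTail_lt_update hk (two_le_prime_cast p)) 1)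
  exact Summable.tsum_lt_tsum (i := ⟨2, Nat.prime_two⟩) (fun p => (hlt p).le) (hlt _)
    (summable_log_factor _) (summable_log_factor _)

lemma H_update_not_ne (x : ℕ → Bool) (k : ℕ) :
    H (setOfBits (Function.update x k (!x k))) ≠ H (setOfBits x) := by
  cases hk : x k
  · exact (H_lt_H_update hk).ne'
  · have h := H_lt_H_update (x := Function.update x k false) (k := k) (by simp)
    rw [Function.update_idem, ← hk, Function.update_eq_self] at h
    exact h.ne

lemma tendsto_update_atTop (x y : ℕ → Bool) :
    Tendsto (fun k => Function.update x k (y k)) atTop (𝓝 x) := by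
  refine tendsto_pi_nhds.mpr fun m => tendsto_const_nhds.congr' ?_
  filter_upwards [eventually_gt_atTop m] with k hk
  rw [Function.update_of_ne hk.ne]

theorem densitySet_perfect : Perfect densitySet := by
  rw [densitySet_eq_range]
  refine ⟨(isCompact_range continuous_H_setOfBits).isClosed, ?_⟩
  rintro _ ⟨x, rfl⟩
  rw [accPt_iff_frequently]
  exact ((continuous_H_setOfBits.tendsto x).comp
    (tendsto_update_atTop x fun k => !x k)).frequently
    (Frequently.of_forall fun k => ⟨H_update_not_ne x k, ⟨_, rfl⟩⟩)
end
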